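/- arXiv:2005.14083 — 2 statements merged into one kernel-verified Lean document; each statement's English description precedes it below -/
import Mathlib

section
/- (Main Theorem) For any σ > 0 and any μ, ξ ∈ ℝ, let g(x; ξ) = e^{-(x-μ)²/(2σ²)} - e^{-(ξx-μ)²/(2σ²)} with Hermite-Gaussian expansion g(x;ξ) = Σ_{n≥0} c_n(ξ) ψ_n(x; μ, σ). Then lim_{ξ→1} [∫_{-∞}^{∞} (g(x;ξ) - c_1(ξ)ψ_1(x;μ,σ))² dx / ∫_{-∞}^{∞} g(x;ξ)² dx] = 1 / (1 + 2μ²/(3σ²)). -/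
open Real MeasureTheory

/-- The `n`-th physicist's Hermite polynomial, via the Rodrigues formula. -/
noncomputable def physHermite (n : ℕ) (x : ℝ) : ℝ :=
  (-1 : ℝ) ^ n * Real.exp (x ^ 2) * iteratedDeriv n (fun t : ℝ => Real.exp (-t ^ 2)) x

/-- The generalized Hermite-Gaussian function `ψ_n(x; μ, σ)`. -/
noncomputable def hermiteGaussian (n : ℕ) (μ σ x : ℝ) : ℝ :=
  (Real.sqrt (σ * 2 ^ n * n.factorial * Real.sqrt Real.pi))⁻¹ *
    physHermite n ((x - μ) / σ) * Real.exp (-(x - μ) ^ 2 / (2 * σ ^ 2))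

/-- The difference between a Gaussian and its Doppler-shifted version. -/
noncomputable def dopplerDiff (μ σ ξ x : ℝ) : ℝ :=
  Real.exp (-(x - μ) ^ 2 / (2 * σ ^ 2)) - Real.exp (-(ξ * x - μ) ^ 2 / (2 * σ ^ 2))

/-- The Hermite-Gaussian expansion coefficients `c_n(ξ)` of `g(·; ξ)`. -/
noncomputable def hgCoeff (n : ℕ) (μ σ ξ : ℝ) : ℝ :=
  ∫ x : ℝ, hermiteGaussian n μ σ x * dopplerDiff μ σ ξ x

lemma aux_int (n : ℕ) {b : ℝ} (hb : 0 < b) :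
    Integrable (fun x : ℝ => x ^ n * Real.exp (-b * x ^ 2)) := by
  have h := integrable_rpow_mul_exp_neg_mul_sq hb (s := (n : ℝ))
    (by have : (0 : ℝ) ≤ n := Nat.cast_nonneg n
        linarith)
  simpa [Real.rpow_natCast] using h

lemma aux_int1 (n : ℕ) : Integrable (fun x : ℝ => x ^ n * Real.exp (-x ^ 2)) := by
  simpa using aux_int n one_pos

lemma aux_rec (n : ℕ) :
    ∫ x : ℝ, x ^ (n + 2) * Real.exp (-x ^ 2) =
      (n + 1) / 2 * ∫ x : ℝ, x ^ n * Real.exp (-x ^ 2) := by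
  have hd : ∀ x : ℝ, HasDerivAt (fun x : ℝ => x ^ (n + 1) * Real.exp (-x ^ 2))
      ((n + 1) * (x ^ n * Real.exp (-x ^ 2)) - 2 * (x ^ (n + 2) * Real.exp (-x ^ 2))) x := by
    intro x
    have h1 := (hasDerivAt_pow (n + 1) x).mul ((hasDerivAt_pow 2 x).neg.exp)
    refine h1.congr_deriv ?_
    simp
    ring
  have h := integral_eq_zero_of_hasDerivAt_of_integrable hd
    (((aux_int1 n).const_mul _).sub ((aux_int1 (n + 2)).const_mul _)) (aux_int1 (n + 1))
  rw [integral_sub ((aux_int1 n).const_mul _) ((aux_int1 (n + 2)).const_mul _),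
    integral_const_mul, integral_const_mul] at h
  linarith

lemma aux_m0 : ∫ x : ℝ, x ^ 0 * Real.exp (-x ^ 2) = √π := by
  simpa using integral_gaussian 1

lemma aux_m2 : ∫ x : ℝ, x ^ 2 * Real.exp (-x ^ 2) = √π / 2 := by
  have := aux_rec 0
  rw [aux_m0] at this
  rw [this]; push_cast; ring

lemma aux_m4 : ∫ x : ℝ, x ^ 4 * Real.exp (-x ^ 2) = 3 / 4 * √π := by
  have := aux_rec 2
  rw [aux_m2] at this
  rw [this]; push_cast; ring

lemma aux_m3 : ∫ x : ℝ, x ^ 3 * Real.exp (-x ^ 2) = 0 := by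
  have h := integral_neg_eq_self (fun x : ℝ => x ^ 3 * Real.exp (-x ^ 2)) volume
  have h2 : (fun x : ℝ => (-x) ^ 3 * Real.exp (-(-x) ^ 2)) =
      fun x => -(x ^ 3 * Real.exp (-x ^ 2)) := by
    funext x
    rw [neg_sq]; ring
  rw [h2, integral_neg] at h
  linarith

lemma aux_subst (F : ℝ → ℝ) (μ σ : ℝ) (hσ : 0 < σ) :
    ∫ x : ℝ, F ((x - μ) / σ) = σ * ∫ y, F y := by
  rw [integral_sub_right_eq_self (fun x => F (x / σ)) μ, Measure.integral_comp_div,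
    abs_of_pos hσ, smul_eq_mul]

lemma aux_subst_int {F : ℝ → ℝ} (hF : Integrable F) (μ σ : ℝ) (hσ : 0 < σ) :
    Integrable (fun x : ℝ => F ((x - μ) / σ)) :=
  (hF.comp_div hσ.ne').comp_sub_right μ

noncomputable def auxK (σ : ℝ) : ℝ := (√(σ * 2 * √π))⁻¹

lemma auxK_sq (σ : ℝ) (hσ : 0 < σ) : auxK σ ^ 2 = (σ * 2 * √π)⁻¹ := by
  unfold auxK
  rw [inv_pow, Real.sq_sqrt (by positivity)]

lemma aux_psi (μ σ x : ℝ) : hermiteGaussian 1 μ σ x =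
    2 * auxK σ * (((x - μ) / σ) * Real.exp (-((x - μ) / σ) ^ 2 / 2)) := by
  have hd : ∀ t : ℝ, deriv (fun t : ℝ => Real.exp (-t ^ 2)) t = Real.exp (-t ^ 2) * (-(2 * t)) := by
    intro t
    have h1 := ((hasDerivAt_pow 2 t).neg.exp)
    refine HasDerivAt.deriv (h1.congr_deriv ?_)
    simp
  have he : -(x - μ) ^ 2 / (2 * σ ^ 2) = -((x - μ) / σ) ^ 2 / 2 := by
    rw [div_pow, neg_div, neg_div, div_div, mul_comm]
  unfold hermiteGaussian physHermite auxK
  rw [iteratedDeriv_one, hd, he]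
  set y := (x - μ) / σ
  have : Real.exp (y ^ 2) * Real.exp (-y ^ 2) = 1 := by
    rw [← Real.exp_add]; simp
  simp only [pow_one, Nat.factorial_one, Nat.cast_one, mul_one]
  linear_combination (2 * (√(σ * 2 * √π))⁻¹ * y * Real.exp (-y ^ 2 / 2)) * this

lemma aux_exp_sq (y : ℝ) : Real.exp (-y ^ 2 / 2) ^ 2 = Real.exp (-y ^ 2) := by
  rw [← Real.exp_nat_mul]; congr 1; push_cast; ring

lemma aux_psi_sq (μ σ : ℝ) : (fun x => hermiteGaussian 1 μ σ x ^ 2) =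
    fun x => (fun y : ℝ => 4 * auxK σ ^ 2 * (y ^ 2 * Real.exp (-y ^ 2))) ((x - μ) / σ) := by
  funext x
  simp only [aux_psi]
  rw [← aux_exp_sq]; ring

lemma aux_psi_sq_int (μ σ : ℝ) (hσ : 0 < σ) :
    Integrable (fun x => hermiteGaussian 1 μ σ x ^ 2) := by
  rw [aux_psi_sq]
  exact aux_subst_int ((aux_int1 2).const_mul _) μ σ hσ

lemma aux_psi_norm (μ σ : ℝ) (hσ : 0 < σ) : ∫ x, hermiteGaussian 1 μ σ x ^ 2 = 1 := by
  rw [aux_psi_sq]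
  refine (aux_subst (fun y : ℝ => 4 * auxK σ ^ 2 * (y ^ 2 * Real.exp (-y ^ 2))) μ σ hσ).trans ?_
  rw [integral_const_mul, aux_m2, auxK_sq σ hσ]
  have : 0 < √π := by positivity
  field_simp
  norm_num

/-- the derivative of the Doppler difference at one. -/
noncomputable def auxH (μ σ x : ℝ) : ℝ :=
  x * (x - μ) / σ ^ 2 * Real.exp (-(x - μ) ^ 2 / (2 * σ ^ 2))

lemma auxH_eq (μ σ x : ℝ) (hσ : 0 < σ) : auxH μ σ x =
    (((x - μ) / σ) ^ 2 + μ / σ * ((x - μ) / σ)) * Real.exp (-((x - μ) / σ) ^ 2 / 2) := by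
  have he : -(x - μ) ^ 2 / (2 * σ ^ 2) = -((x - μ) / σ) ^ 2 / 2 := by
    rw [div_pow, neg_div, neg_div, div_div, mul_comm]
  unfold auxH
  rw [he]
  congr 1
  field_simp
  ring

lemma auxH_sq (μ σ : ℝ) (hσ : 0 < σ) :
    ∫ x, auxH μ σ x ^ 2 = σ * ((3 / 4 + (μ / σ) ^ 2 / 2) * √π) := by
  have : (fun x => auxH μ σ x ^ 2) =
    fun x => (fun y : ℝ => y ^ 4 * Real.exp (-y ^ 2) + (2 * (μ / σ) * (y ^ 3 * Real.exp (-y ^ 2))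
      + (μ / σ) ^ 2 * (y ^ 2 * Real.exp (-y ^ 2)))) ((x - μ) / σ) := by
    funext x
    simp only [auxH_eq μ σ x hσ]
    rw [← aux_exp_sq]; ring
  have i23 : Integrable (fun y : ℝ => 2 * (μ / σ) * (y ^ 3 * Real.exp (-y ^ 2))
      + (μ / σ) ^ 2 * (y ^ 2 * Real.exp (-y ^ 2))) :=
    ((aux_int1 3).const_mul _).add ((aux_int1 2).const_mul _)
  rw [this]
  refine (aux_subst (fun y : ℝ => y ^ 4 * Real.exp (-y ^ 2) +
    (2 * (μ / σ) * (y ^ 3 * Real.exp (-y ^ 2)) + (μ / σ) ^ 2 * (y ^ 2 * Real.exp (-y ^ 2)))) μ σ hσ).trans ?_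
  rw [integral_add (aux_int1 4) i23,
    integral_add ((aux_int1 3).const_mul _) ((aux_int1 2).const_mul _), integral_const_mul,
    integral_const_mul, aux_m2, aux_m3, aux_m4]
  ring

lemma auxH_psi (μ σ : ℝ) (hσ : 0 < σ) :
    ∫ x, hermiteGaussian 1 μ σ x * auxH μ σ x = auxK σ * σ * (μ / σ) * √π := by
  have : (fun x => hermiteGaussian 1 μ σ x * auxH μ σ x) =
    fun x => (fun y : ℝ => 2 * auxK σ * (y ^ 3 * Real.exp (-y ^ 2))
      + 2 * auxK σ * (μ / σ) * (y ^ 2 * Real.exp (-y ^ 2))) ((x - μ) / σ) := by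
    funext x
    simp only [auxH_eq μ σ x hσ, aux_psi]
    rw [← aux_exp_sq]; ring
  rw [this]
  refine (aux_subst (fun y : ℝ => 2 * auxK σ * (y ^ 3 * Real.exp (-y ^ 2))
      + 2 * auxK σ * (μ / σ) * (y ^ 2 * Real.exp (-y ^ 2))) μ σ hσ).trans ?_
  rw [
    integral_add ((aux_int1 3).const_mul _) ((aux_int1 2).const_mul _), integral_const_mul,
    integral_const_mul, aux_m2, aux_m3]
  ring

noncomputable def auxB (μ σ x : ℝ) : ℝ :=
  Real.exp (μ ^ 2 / (2 * σ ^ 2)) / σ ^ 2 *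
    ((3 * x ^ 2 + μ ^ 2) * Real.exp (-(16 * σ ^ 2)⁻¹ * x ^ 2))

lemma auxB_int (μ σ : ℝ) (hσ : 0 < σ) : Integrable (fun x => auxB μ σ x ^ 2) := by
  have hb : 0 < 2 * (16 * σ ^ 2)⁻¹ := by positivity
  have : (fun x => auxB μ σ x ^ 2) = fun x => (Real.exp (μ ^ 2 / (2 * σ ^ 2)) / σ ^ 2) ^ 2 *
     (9 * (x ^ 4 * Real.exp (-(2 * (16 * σ ^ 2)⁻¹) * x ^ 2)) +
      6 * μ ^ 2 * (x ^ 2 * Real.exp (-(2 * (16 * σ ^ 2)⁻¹) * x ^ 2)) +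
      μ ^ 4 * (x ^ 0 * Real.exp (-(2 * (16 * σ ^ 2)⁻¹) * x ^ 2))) := by
    funext x
    have : Real.exp (-(2 * (16 * σ ^ 2)⁻¹) * x ^ 2) =
        Real.exp (-(16 * σ ^ 2)⁻¹ * x ^ 2) ^ 2 := by
      rw [← Real.exp_nat_mul]; congr 1; push_cast; ring
    rw [this]; unfold auxB; ring
  rw [this]
  exact ((((aux_int 4 hb).const_mul _).add ((aux_int 2 hb).const_mul _)).add
    ((aux_int 0 hb).const_mul _)).const_mul _

lemma aux_hasDeriv (μ σ x η : ℝ) : HasDerivAt (fun ξ => dopplerDiff μ σ ξ x)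
    (x * (η * x - μ) / σ ^ 2 * Real.exp (-(η * x - μ) ^ 2 / (2 * σ ^ 2))) η := by
  unfold dopplerDiff
  have h0 : HasDerivAt (fun ξ : ℝ => ξ * x - μ) x η := by
    simpa using ((hasDerivAt_id η).mul_const x).sub_const μ
  have h1 := (((h0.pow 2).neg.div_const (2 * σ ^ 2)).exp).const_sub
    (Real.exp (-(x - μ) ^ 2 / (2 * σ ^ 2)))
  refine h1.congr_deriv ?_
  simp
  ring

lemma aux_deriv_bound (μ σ x η : ℝ) (hσ : 0 < σ) (hη : η ∈ Set.Icc (1 / 2 : ℝ) (3 / 2)) :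
    ‖x * (η * x - μ) / σ ^ 2 * Real.exp (-(η * x - μ) ^ 2 / (2 * σ ^ 2))‖ ≤ auxB μ σ x := by
  obtain ⟨h1, h2⟩ := hη
  have e1 : Real.exp (-(η * x - μ) ^ 2 / (2 * σ ^ 2)) ≤
      Real.exp (μ ^ 2 / (2 * σ ^ 2)) * Real.exp (-(16 * σ ^ 2)⁻¹ * x ^ 2) := by
    rw [← Real.exp_add]
    apply Real.exp_le_exp.mpr
    have : μ ^ 2 / (2 * σ ^ 2) + -(16 * σ ^ 2)⁻¹ * x ^ 2 =
        (μ ^ 2 - x ^ 2 / 8) / (2 * σ ^ 2) := by field_simp; ring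
    rw [this]
    apply div_le_div_of_nonneg_right _ (by positivity)
    have : x ^ 2 * (1 / 4) ≤ x ^ 2 * η ^ 2 := by
      apply mul_le_mul_of_nonneg_left _ (sq_nonneg x); nlinarith
    nlinarith [sq_nonneg (η * x - 2 * μ)]
  have e2 : |x * (η * x - μ)| ≤ 3 * x ^ 2 + μ ^ 2 := by
    have a1 : 0 ≤ x ^ 2 * (η - 1 / 2) := mul_nonneg (sq_nonneg x) (by linarith)
    have a2 : 0 ≤ x ^ 2 * (3 / 2 - η) := mul_nonneg (sq_nonneg x) (by linarith)
    rw [abs_le]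
    constructor <;> nlinarith [sq_nonneg (x - μ), sq_nonneg (x + μ), sq_nonneg x, sq_nonneg μ]
  rw [norm_mul, norm_div, Real.norm_eq_abs, Real.norm_eq_abs, Real.norm_eq_abs,
    abs_of_pos (Real.exp_pos _), abs_of_nonneg (sq_nonneg σ)]
  calc _ ≤ (3 * x ^ 2 + μ ^ 2) / σ ^ 2 *
        (Real.exp (μ ^ 2 / (2 * σ ^ 2)) * Real.exp (-(16 * σ ^ 2)⁻¹ * x ^ 2)) := by gcongr
    _ = auxB μ σ x := by unfold auxB; ring

lemma aux_d_one (μ σ x : ℝ) : dopplerDiff μ σ 1 x = 0 := by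
  simp [dopplerDiff]

noncomputable def auxQ (μ σ ξ x : ℝ) : ℝ := (ξ - 1)⁻¹ * dopplerDiff μ σ ξ x

lemma auxQ_bound (μ σ x ξ : ℝ) (hσ : 0 < σ) (hξ : ξ ∈ Set.Icc (1 / 2 : ℝ) (3 / 2)) (h1 : ξ ≠ 1) :
    |auxQ μ σ ξ x| ≤ auxB μ σ x := by
  have h := Convex.norm_image_sub_le_of_norm_hasDerivWithin_le
    (fun η _ => (aux_hasDeriv μ σ x η).hasDerivWithinAt)
    (fun η hη => aux_deriv_bound μ σ x η hσ hη) (convex_Icc (1 / 2 : ℝ) (3 / 2))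
    (x := 1) (by norm_num) hξ
  rw [aux_d_one, sub_zero, Real.norm_eq_abs, Real.norm_eq_abs] at h
  have hp : 0 < |ξ - 1| := abs_pos.mpr (sub_ne_zero.mpr h1)
  unfold auxQ
  rw [abs_mul, abs_inv, inv_mul_le_iff₀ hp]
  linarith

lemma auxQ_cont (μ σ ξ : ℝ) : Continuous (auxQ μ σ ξ) := by
  unfold auxQ dopplerDiff
  fun_prop

lemma aux_psi_cont (μ σ : ℝ) : Continuous (hermiteGaussian 1 μ σ) := by
  have : hermiteGaussian 1 μ σ = _ := funext (aux_psi μ σ)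
  rw [this]
  fun_prop

lemma auxQ_lim (μ σ x : ℝ) :
    Filter.Tendsto (fun ξ => auxQ μ σ ξ x) (nhdsWithin 1 {(1 : ℝ)}ᶜ) (nhds (auxH μ σ x)) := by
  have h := hasDerivAt_iff_tendsto_slope.mp (aux_hasDeriv μ σ x 1)
  have e : slope (fun ξ => dopplerDiff μ σ ξ x) 1 = fun ξ => auxQ μ σ ξ x := by
    funext ξ
    simp [slope, auxQ, aux_d_one]
  rw [e] at h
  simpa [auxH] using h

lemma aux_ev : ∀ᶠ ξ in nhdsWithin (1 : ℝ) {(1 : ℝ)}ᶜ,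
    ξ ∈ Set.Icc (1 / 2 : ℝ) (3 / 2) ∧ ξ ≠ 1 := by
  refine Filter.Eventually.and ?_ self_mem_nhdsWithin
  exact mem_nhdsWithin_of_mem_nhds (Icc_mem_nhds (by norm_num) (by norm_num))

lemma aux_sq_bound {a b : ℝ} (h : |a| ≤ b) : ‖a ^ 2‖ ≤ b ^ 2 := by
  rw [norm_pow, Real.norm_eq_abs]
  gcongr

lemma aux_mul_bound {p a b : ℝ} (h : |a| ≤ b) : ‖p * a‖ ≤ p ^ 2 + b ^ 2 := by
  have h2 := aux_sq_bound h
  rw [norm_pow] at h2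
  rw [norm_mul, ← sq_abs p, ← Real.norm_eq_abs p]
  nlinarith [sq_nonneg (‖p‖ - ‖a‖), sq_nonneg ‖p‖, sq_nonneg ‖a‖]

lemma auxQ_sq_int (μ σ ξ : ℝ) (hσ : 0 < σ) (hξ : ξ ∈ Set.Icc (1 / 2 : ℝ) (3 / 2)) (h1 : ξ ≠ 1) :
    Integrable (fun x => auxQ μ σ ξ x ^ 2) :=
  (auxB_int μ σ hσ).mono' ((auxQ_cont μ σ ξ).pow 2).aestronglyMeasurable
    (Filter.Eventually.of_forall fun x => aux_sq_bound (auxQ_bound μ σ x ξ hσ hξ h1))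

lemma auxQ_psi_int (μ σ ξ : ℝ) (hσ : 0 < σ) (hξ : ξ ∈ Set.Icc (1 / 2 : ℝ) (3 / 2)) (h1 : ξ ≠ 1) :
    Integrable (fun x => hermiteGaussian 1 μ σ x * auxQ μ σ ξ x) :=
  ((aux_psi_sq_int μ σ hσ).add (auxB_int μ σ hσ)).mono'
    ((aux_psi_cont μ σ).mul (auxQ_cont μ σ ξ)).aestronglyMeasurable
    (Filter.Eventually.of_forall fun x => aux_mul_bound (auxQ_bound μ σ x ξ hσ hξ h1))

lemma aux_lim_sq (μ σ : ℝ) (hσ : 0 < σ) :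
    Filter.Tendsto (fun ξ => ∫ x, auxQ μ σ ξ x ^ 2) (nhdsWithin 1 {(1 : ℝ)}ᶜ)
      (nhds (∫ x, auxH μ σ x ^ 2)) := by
  refine tendsto_integral_filter_of_dominated_convergence (fun x => auxB μ σ x ^ 2) ?_ ?_
    (auxB_int μ σ hσ) ?_
  · exact Filter.Eventually.of_forall fun ξ => ((auxQ_cont μ σ ξ).pow 2).aestronglyMeasurable
  · filter_upwards [aux_ev] with ξ hξ
    exact Filter.Eventually.of_forall fun x => aux_sq_bound (auxQ_bound μ σ x ξ hσ hξ.1 hξ.2)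
  · exact Filter.Eventually.of_forall fun x => (auxQ_lim μ σ x).pow 2

lemma aux_lim_psi (μ σ : ℝ) (hσ : 0 < σ) :
    Filter.Tendsto (fun ξ => ∫ x, hermiteGaussian 1 μ σ x * auxQ μ σ ξ x)
      (nhdsWithin 1 {(1 : ℝ)}ᶜ) (nhds (∫ x, hermiteGaussian 1 μ σ x * auxH μ σ x)) := by
  refine tendsto_integral_filter_of_dominated_convergence
    (fun x => hermiteGaussian 1 μ σ x ^ 2 + auxB μ σ x ^ 2) ?_ ?_
    ((aux_psi_sq_int μ σ hσ).add (auxB_int μ σ hσ)) ?_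
  · exact Filter.Eventually.of_forall fun ξ =>
      ((aux_psi_cont μ σ).mul (auxQ_cont μ σ ξ)).aestronglyMeasurable
  · filter_upwards [aux_ev] with ξ hξ
    exact Filter.Eventually.of_forall fun x => aux_mul_bound (auxQ_bound μ σ x ξ hσ hξ.1 hξ.2)
  · exact Filter.Eventually.of_forall fun x => (auxQ_lim μ σ x).const_mul _

lemma aux_ratio (μ σ ξ : ℝ) (hσ : 0 < σ) (hξ : ξ ∈ Set.Icc (1 / 2 : ℝ) (3 / 2)) (h1 : ξ ≠ 1) :
    (∫ x : ℝ, (dopplerDiff μ σ ξ x - hgCoeff 1 μ σ ξ * hermiteGaussian 1 μ σ x) ^ 2) /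
          (∫ x : ℝ, (dopplerDiff μ σ ξ x) ^ 2) =
    ((∫ x, auxQ μ σ ξ x ^ 2) - (∫ x, hermiteGaussian 1 μ σ x * auxQ μ σ ξ x) ^ 2) /
      ∫ x, auxQ μ σ ξ x ^ 2 := by
  have hn : ξ - 1 ≠ 0 := sub_ne_zero.mpr h1
  have hd : ∀ x, dopplerDiff μ σ ξ x = (ξ - 1) * auxQ μ σ ξ x := by
    intro x; unfold auxQ; field_simp
  set c := ∫ x, hermiteGaussian 1 μ σ x * auxQ μ σ ξ x with hc
  have hcc : hgCoeff 1 μ σ ξ = (ξ - 1) * c := by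
    unfold hgCoeff
    rw [hc, ← integral_const_mul]
    congr 1; funext x; rw [hd]; ring
  have hden : ∫ x : ℝ, (dopplerDiff μ σ ξ x) ^ 2 = (ξ - 1) ^ 2 * ∫ x, auxQ μ σ ξ x ^ 2 := by
    rw [← integral_const_mul]
    congr 1; funext x; rw [hd]; ring
  have hnum : ∫ x : ℝ, (dopplerDiff μ σ ξ x - hgCoeff 1 μ σ ξ * hermiteGaussian 1 μ σ x) ^ 2 =
      (ξ - 1) ^ 2 * ((∫ x, auxQ μ σ ξ x ^ 2) - c ^ 2) := by
    have e : (fun x => (dopplerDiff μ σ ξ x - hgCoeff 1 μ σ ξ * hermiteGaussian 1 μ σ x) ^ 2) =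
        fun x => (ξ - 1) ^ 2 * (auxQ μ σ ξ x ^ 2 -
          2 * c * (hermiteGaussian 1 μ σ x * auxQ μ σ ξ x) +
          c ^ 2 * hermiteGaussian 1 μ σ x ^ 2) := by
      funext x; rw [hd, hcc]; ring
    have i1 := auxQ_sq_int μ σ ξ hσ hξ h1
    have i2 := (auxQ_psi_int μ σ ξ hσ hξ h1).const_mul (2 * c)
    have i3 := (aux_psi_sq_int μ σ hσ).const_mul (c ^ 2)
    have i12 : Integrable (fun x => auxQ μ σ ξ x ^ 2 -
          2 * c * (hermiteGaussian 1 μ σ x * auxQ μ σ ξ x)) := i1.sub i2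
    rw [e, integral_const_mul, integral_add i12 i3, integral_sub i1 i2,
      integral_const_mul, integral_const_mul, aux_psi_norm μ σ hσ, ← hc]
    ring
  rw [hnum, hden, mul_div_mul_left _ _ (pow_ne_zero 2 hn)]

open Filter in
/-- Main theorem: the standardized approximation error of modeling the
Doppler-shifted Gaussian difference with only the first-degree Hermite-Gaussian
term tends to `1 / (1 + 2μ²/(3σ²))` as `ξ → 1`. -/
theorem standardized_approx_error_limit (μ σ : ℝ) (hσ : 0 < σ) :
    Tendsto
      (fun ξ : ℝ =>
        (∫ x : ℝ, (dopplerDiff μ σ ξ x - hgCoeff 1 μ σ ξ * hermiteGaussian 1 μ σ x) ^ 2) /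
          (∫ x : ℝ, (dopplerDiff μ σ ξ x) ^ 2))
      (nhdsWithin 1 {(1 : ℝ)}ᶜ) (nhds (1 / (1 + 2 * μ ^ 2 / (3 * σ ^ 2)))) := by
  have hpi : 0 < √π := by positivity
  have hpos : 0 < σ * ((3 / 4 + (μ / σ) ^ 2 / 2) * √π) := by positivity
  have h1 := aux_lim_sq μ σ hσ
  have h2 := aux_lim_psi μ σ hσ
  rw [auxH_sq μ σ hσ] at h1
  rw [auxH_psi μ σ hσ] at h2
  have h3 := (h1.sub (h2.pow 2)).div h1 hpos.ne'
  have hval : (σ * ((3 / 4 + (μ / σ) ^ 2 / 2) * √π) - (auxK σ * σ * (μ / σ) * √π) ^ 2) /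
      (σ * ((3 / 4 + (μ / σ) ^ 2 / 2) * √π)) = 1 / (1 + 2 * μ ^ 2 / (3 * σ ^ 2)) := by
    have e : (auxK σ * σ * (μ / σ) * √π) ^ 2 = σ * ((μ / σ) ^ 2 / 2 * √π) := by
      rw [mul_pow, mul_pow, mul_pow, auxK_sq σ hσ]
      field_simp
    have hq : 0 < 1 + 2 * μ ^ 2 / (3 * σ ^ 2) := by positivity
    rw [e, div_eq_div_iff hpos.ne' hq.ne']
    field_simp
    ring
  rw [hval] at h3
  refine h3.congr' ?_
  filter_upwards [aux_ev] with ξ hξ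
  exact (aux_ratio μ σ ξ hσ hξ.1 hξ.2).symm
end

section
/- For σ > 0 and μ ∈ ℝ, with c_1(ε) = √(√π)/√(2σ) · ε μ (1+ε) h̃(ε) the first Hermite-Gaussian coefficient of the Doppler-shifted Gaussian difference (where h̃ is continuous with h̃(0) = 2√2/((2)^{3/2}) appropriately normalized so that the following holds), the limit of the derivative satisfies lim_{ε→0} d/dε c_1(ε) = μ√(√π)/√(2σ). Consequently, under the classical Doppler relation ε = v_r/c, one has lim_{v_r→0} d/dv_r c_1(v_r) = μ√(√π)/(c√(2σ)), so c_1 ≈ (μ√(√π)/(c√(2σ))) v_r for small v_r. -/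
open Real MeasureTheory

lemma physHermite_one (x : ℝ) : physHermite 1 x = 2 * x := by
  have h : HasDerivAt (fun t : ℝ => Real.exp (-t ^ 2)) (Real.exp (-x ^ 2) * (-(2 * x))) x := by
    have := ((hasDerivAt_pow 2 x).neg).exp
    simpa using this
  unfold physHermite
  rw [iteratedDeriv_one, h.deriv, Real.exp_neg]
  have := (Real.exp_pos (x ^ 2)).ne'
  field_simp

lemma int_shift {s : ℝ} (hs : 0 < s) (μ m : ℝ) :
    Integrable (fun x : ℝ => (x - μ) * Real.exp (-s * (x - m) ^ 2)) ∧
      ∫ x : ℝ, (x - μ) * Real.exp (-s * (x - m) ^ 2) = (m - μ) * Real.sqrt (Real.pi / s) := by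
  have h1 : Integrable (fun x : ℝ => x * Real.exp (-s * x ^ 2)) :=
    integrable_mul_exp_neg_mul_sq hs
  have h2 : Integrable (fun x : ℝ => (m - μ) * Real.exp (-s * x ^ 2)) :=
    (integrable_exp_neg_mul_sq hs).const_mul _
  have h0 : ∫ x : ℝ, x * Real.exp (-s * x ^ 2) = 0 := by
    have := integral_neg_eq_self (fun x : ℝ => x * Real.exp (-s * x ^ 2)) volume
    simp only [neg_sq, neg_mul] at this
    rw [integral_neg] at this
    simp only [neg_mul]
    linarith
  have he : (fun x : ℝ => (x - μ) * Real.exp (-s * (x - m) ^ 2)) =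
      fun x : ℝ => (fun y : ℝ => y * Real.exp (-s * y ^ 2) + (m - μ) * Real.exp (-s * y ^ 2))
        (x - m) := by
    funext x
    simp only
    ring
  rw [he]
  refine ⟨(h1.add h2).comp_sub_right m, ?_⟩
  rw [integral_sub_right_eq_self
    (fun y : ℝ => y * Real.exp (-s * y ^ 2) + (m - μ) * Real.exp (-s * y ^ 2)) m,
    integral_add h1 h2, h0, integral_const_mul, integral_gaussian, zero_add]

/-- The smooth cofactor of `ε` in the closed form of the coefficient. -/
noncomputable def cofac (μ σ ε : ℝ) : ℝ :=
  (Real.sqrt (σ * 2 * Real.sqrt Real.pi))⁻¹ * (2 / σ) *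
    (μ * (1 + ε) / (1 + (1 + ε) ^ 2)) *
    Real.sqrt (Real.pi / ((1 + (1 + ε) ^ 2) / (2 * σ ^ 2))) *
    Real.exp (-(μ ^ 2 * ε ^ 2) / (2 * σ ^ 2 * (1 + (1 + ε) ^ 2)))

lemma hgCoeff_closed (μ σ : ℝ) (hσ : 0 < σ) (ε : ℝ) :
    hgCoeff 1 μ σ (1 + ε) = ε * cofac μ σ ε := by
  have hp : 0 < 1 + (1 + ε) ^ 2 := by positivity
  obtain ⟨i1, e1⟩ := int_shift (s := 1 / σ ^ 2) (by positivity) μ μ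
  obtain ⟨i2, e2⟩ := int_shift (s := (1 + (1 + ε) ^ 2) / (2 * σ ^ 2)) (by positivity) μ
    (μ * (2 + ε) / (1 + (1 + ε) ^ 2))
  set K := (Real.sqrt (σ * 2 * Real.sqrt Real.pi))⁻¹ with hK
  set E := Real.exp (-(μ ^ 2 * ε ^ 2) / (2 * σ ^ 2 * (1 + (1 + ε) ^ 2))) with hE
  have he : (fun x => hermiteGaussian 1 μ σ x * dopplerDiff μ σ (1 + ε) x) = fun x =>
      (K * (2 / σ)) * ((x - μ) * Real.exp (-(1 / σ ^ 2) * (x - μ) ^ 2)) -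
      (K * (2 / σ) * E) * ((x - μ) * Real.exp (-((1 + (1 + ε) ^ 2) / (2 * σ ^ 2)) *
        (x - μ * (2 + ε) / (1 + (1 + ε) ^ 2)) ^ 2)) := by
    funext x
    have a1 : Real.exp (-(1 / σ ^ 2) * (x - μ) ^ 2) =
        Real.exp (-(x - μ) ^ 2 / (2 * σ ^ 2)) * Real.exp (-(x - μ) ^ 2 / (2 * σ ^ 2)) := by
      rw [← Real.exp_add]
      congr 1
      field_simp
      ring
    have a2 : E * Real.exp (-((1 + (1 + ε) ^ 2) / (2 * σ ^ 2)) *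
        (x - μ * (2 + ε) / (1 + (1 + ε) ^ 2)) ^ 2) =
        Real.exp (-(x - μ) ^ 2 / (2 * σ ^ 2)) *
          Real.exp (-((1 + ε) * x - μ) ^ 2 / (2 * σ ^ 2)) := by
      rw [hE, ← Real.exp_add, ← Real.exp_add]
      congr 1
      field_simp
      ring
    unfold hermiteGaussian dopplerDiff
    rw [physHermite_one]
    have hk : (Real.sqrt (σ * 2 ^ 1 * (Nat.factorial 1 : ℕ) * Real.sqrt Real.pi))⁻¹ = K := by
      simp [hK]
    rw [hk, a1]
    linear_combination (K * (2 / σ) * (x - μ)) * a2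
  unfold hgCoeff cofac
  rw [he, integral_sub (i1.const_mul _) (i2.const_mul _), integral_const_mul, integral_const_mul,
    e1, e2, ← hK, ← hE]
  field_simp
  ring

lemma cofac_contDiff (μ σ : ℝ) (hσ : 0 < σ) : ContDiff ℝ 1 (cofac μ σ) := by
  have hp : ∀ ε : ℝ, 1 + (1 + ε) ^ 2 ≠ 0 := fun ε => by positivity
  have hq : ∀ ε : ℝ, (1 + (1 + ε) ^ 2) / (2 * σ ^ 2) ≠ 0 := fun ε => by positivity
  have hr : ∀ ε : ℝ, Real.pi / ((1 + (1 + ε) ^ 2) / (2 * σ ^ 2)) ≠ 0 := fun ε => by positivity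
  have ht : ∀ ε : ℝ, 2 * σ ^ 2 * (1 + (1 + ε) ^ 2) ≠ 0 := fun ε => by positivity
  have c0 : ContDiff ℝ 1 (fun ε : ℝ => 1 + (1 + ε) ^ 2) := by fun_prop
  unfold cofac
  refine ContDiff.mul (ContDiff.mul (contDiff_const.mul ?_) ?_) ?_
  · exact ContDiff.div (by fun_prop) c0 hp
  · exact ContDiff.sqrt (contDiff_const.div (c0.div_const _) hq) hr
  · exact ContDiff.exp (ContDiff.div (by fun_prop) (contDiff_const.mul c0) ht)

lemma cofac_zero (μ σ : ℝ) (hσ : 0 < σ) :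
    cofac μ σ 0 = μ * Real.sqrt (Real.sqrt Real.pi) / Real.sqrt (2 * σ) := by
  unfold cofac
  have h1 : Real.pi / ((1 + (1 + (0:ℝ)) ^ 2) / (2 * σ ^ 2)) = Real.pi * σ ^ 2 := by
    field_simp
    norm_num
  have hpi := Real.pi_pos
  have h2 : Real.sqrt (Real.sqrt Real.pi) * Real.sqrt (Real.sqrt Real.pi) = Real.sqrt Real.pi :=
    Real.mul_self_sqrt (by positivity)
  rw [h1, Real.sqrt_mul hpi.le, Real.sqrt_sq hσ.le, mul_comm σ 2,
    Real.sqrt_mul (by positivity) (Real.sqrt Real.pi), ← h2]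
  have h3 : 0 < Real.sqrt (Real.sqrt Real.pi) := by positivity
  have h4 : 0 < Real.sqrt (2 * σ) := by positivity
  simp only [ne_eq, OfNat.ofNat_ne_zero, not_false_eq_true, zero_pow, mul_zero, neg_zero,
    zero_div, Real.exp_zero, add_zero, mul_one, one_pow]
  field_simp
  norm_num
  ring

open Filter in
/-- At small shifts, the first Hermite-Gaussian coefficient is approximately linear
in `ε` (resp. in the radial velocity `v_r = c ε`), with slope `μ π^{1/4} / √(2σ)`
(resp. `μ π^{1/4} / (c √(2σ))`). -/
theorem deriv_hgCoeff_one_limit (μ σ : ℝ) (hσ : 0 < σ) (c : ℝ) (hc : 0 < c) :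
    Tendsto (deriv fun ε : ℝ => hgCoeff 1 μ σ (1 + ε)) (nhds 0)
        (nhds (μ * Real.sqrt (Real.sqrt Real.pi) / Real.sqrt (2 * σ))) ∧
      Tendsto (deriv fun v : ℝ => hgCoeff 1 μ σ (1 + v / c)) (nhds 0)
        (nhds (μ * Real.sqrt (Real.sqrt Real.pi) / (c * Real.sqrt (2 * σ)))) := by
  have hF : (fun ε : ℝ => hgCoeff 1 μ σ (1 + ε)) = fun ε => ε * cofac μ σ ε :=
    funext (hgCoeff_closed μ σ hσ)
  have hG : (fun v : ℝ => hgCoeff 1 μ σ (1 + v / c)) = fun v => (v / c) * cofac μ σ (v / c) :=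
    funext fun v => hgCoeff_closed μ σ hσ (v / c)
  have hC : ContDiff ℝ 1 (fun ε : ℝ => ε * cofac μ σ ε) := contDiff_id.mul (cofac_contDiff μ σ hσ)
  have hD : ContDiff ℝ 1 (fun v : ℝ => (v / c) * cofac μ σ (v / c)) :=
    hC.comp (contDiff_id.div_const c)
  have d1 : HasDerivAt (fun ε : ℝ => ε * cofac μ σ ε) (cofac μ σ 0) 0 := by
    have hd := ((cofac_contDiff μ σ hσ).differentiable one_ne_zero 0).hasDerivAt
    simpa using (hasDerivAt_id (0 : ℝ)).fun_mul hd
  have d2 : HasDerivAt (fun v : ℝ => (v / c) * cofac μ σ (v / c)) (cofac μ σ 0 * (1 / c)) 0 := by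
    have hl : HasDerivAt (fun v : ℝ => v / c) (1 / c) 0 := (hasDerivAt_id (0 : ℝ)).div_const c
    have d1' : HasDerivAt (fun ε : ℝ => ε * cofac μ σ ε) (cofac μ σ 0) ((0 : ℝ) / c) := by
      rwa [zero_div]
    exact HasDerivAt.comp (0 : ℝ) d1' hl
  rw [hF, hG]
  constructor
  · have := (hC.continuous_deriv le_rfl).tendsto 0
    rwa [d1.deriv, cofac_zero μ σ hσ] at this
  · have := (hD.continuous_deriv le_rfl).tendsto 0
    rw [d2.deriv, cofac_zero μ σ hσ] at this
    convert this using 2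
    field_simp
end
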